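/- For every natural number n ≥ 2, one has d(2n−4, 4) = c_n − 3·c_{n−1} + c_{n−2}. -/

import Mathlib

open Finset

/-- Step value: `true` is an up-step (+1), `false` a down-step (−1). -/
def dyckStep (b : Bool) : ℤ := if b then 1 else -1

/-- Sum of the first `k` steps of the path `w`. -/
def dyckPSum {m : ℕ} (w : Fin m → Bool) (k : ℕ) : ℤ :=
  ∑ t ∈ Finset.univ.filter (fun t : Fin m => (t : ℕ) < k), dyckStep (w t)

/-- `dyckD i j`: the number of lattice paths of length `i` from `(0,0)` to `(i,j)`
using steps `(1,1)` and `(1,-1)` that never go below the x-axis; equivalently the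
number of `±1`-lists of length `i` all of whose partial sums are nonnegative and
whose total sum is `j`. -/
def dyckD (i j : ℕ) : ℕ :=
  (Finset.univ.filter (fun w : Fin i → Bool =>
    (∀ k ≤ i, 0 ≤ dyckPSum w k) ∧ dyckPSum w i = (j : ℤ))).card

/-- Appending a step does not change the earlier partial sums. -/
lemma dyckPSum_snoc_of_le {i : ℕ} (w : Fin i → Bool) (b : Bool) {k : ℕ} (hk : k ≤ i) :
    dyckPSum (Fin.snoc w b : Fin (i + 1) → Bool) k = dyckPSum w k := by
  unfold dyckPSum
  rw [Finset.sum_filter, Finset.sum_filter, Fin.sum_univ_castSucc]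
  simp [hk]

/-- Appending a step adds its value to the total sum. -/
lemma dyckPSum_snoc_last {i : ℕ} (w : Fin i → Bool) (b : Bool) :
    dyckPSum (Fin.snoc w b : Fin (i + 1) → Bool) (i + 1) = dyckPSum w i + dyckStep b := by
  unfold dyckPSum
  rw [Finset.sum_filter, Finset.sum_filter, Fin.sum_univ_castSucc]
  simp

lemma snoc_isPath_iff {i : ℕ} (w : Fin i → Bool) (b : Bool) (j : ℕ) :
    ((∀ k ≤ i + 1, 0 ≤ dyckPSum (Fin.snoc w b : Fin (i + 1) → Bool) k) ∧
      dyckPSum (Fin.snoc w b : Fin (i + 1) → Bool) (i + 1) = (j : ℤ)) ↔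
    (∀ k ≤ i, 0 ≤ dyckPSum w k) ∧ dyckPSum w i = (j : ℤ) - dyckStep b := by
  rw [dyckPSum_snoc_last]
  constructor
  · rintro ⟨h, hj⟩
    refine ⟨fun k hk => ?_, by lia⟩
    rw [← dyckPSum_snoc_of_le w b hk]
    exact h k (by lia)
  · rintro ⟨h, hj⟩
    refine ⟨fun k hk => ?_, by lia⟩
    rcases Nat.le_succ_iff.mp hk with hk | rfl
    · rw [dyckPSum_snoc_of_le w b hk]
      exact h k hk
    · rw [dyckPSum_snoc_last]
      lia

lemma dyckD_succ_eq_add (i j : ℕ) :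
    dyckD (i + 1) j =
      (univ.filter fun w : Fin i → Bool =>
        (∀ k ≤ i, 0 ≤ dyckPSum w k) ∧ dyckPSum w i = (j : ℤ) - 1).card + dyckD i (j + 1) := by
  unfold dyckD
  simp only [Finset.card_filter]
  rw [← Equiv.sum_comp (Fin.snocEquiv fun _ => Bool), Fintype.sum_prod_type, Fintype.sum_bool]
  simp only [Fin.snocEquiv, Equiv.coe_fn_mk, snoc_isPath_iff]
  simp [dyckStep]

lemma dyckD_succ_zero (i : ℕ) : dyckD (i + 1) 0 = dyckD i 1 := by
  rw [dyckD_succ_eq_add, Finset.filter_eq_empty_iff.mpr]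
  · simp
  · rintro w - ⟨h, hj⟩
    have := h i le_rfl
    lia

lemma dyckD_succ_succ (i j : ℕ) :
    dyckD (i + 1) (j + 1) = dyckD i j + dyckD i (j + 2) := by
  rw [dyckD_succ_eq_add]
  simp [dyckD, add_assoc, one_add_one_eq_two]

lemma dyckD_zero (j : ℕ) : dyckD 0 j = if j = 0 then 1 else 0 := by
  cases j <;> simp [dyckD, dyckPSum]
  lia

/-- The ballot formula. -/
lemma dyckD_eq_choose_sub_choose (i j a : ℕ) (h : i + j = 2 * a) :
    (dyckD i j : ℤ) = i.choose a - i.choose (a + 1) := by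
  induction i generalizing j a with
  | zero => rw [dyckD_zero]; cases a <;> simp <;> lia
  | succ i ih =>
    obtain ⟨a, rfl⟩ : ∃ b, a = b + 1 := ⟨a - 1, by lia⟩
    rw [Nat.choose_succ_succ, Nat.choose_succ_succ]
    cases j with
    | zero =>
      rw [dyckD_succ_zero, ih 1 (a + 1) (by lia),
        Nat.choose_symm_of_eq_add (show i = a + (a + 1) by lia)]
      push_cast
      ring
    | succ j =>
      rw [dyckD_succ_succ, Nat.cast_add, ih j a (by lia), ih (j + 2) (a + 1) (by lia)]
      push_cast
      ring

lemma dyckD_two_mul_zero (n : ℕ) : dyckD (2 * n) 0 = catalan n := by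
  have h := dyckD_eq_choose_sub_choose (2 * n) 0 n (by simp)
  have hc := succ_mul_catalan_eq_centralBinom n
  have hs := Nat.choose_succ_right_eq (2 * n) n
  rw [Nat.centralBinom_eq_two_mul_choose] at hc
  rw [show 2 * n - n = n by lia] at hs
  zify at hc hs ⊢
  refine mul_left_cancel₀ (show (n + 1 : ℤ) ≠ 0 by positivity) ?_
  rw [h, hc]
  linear_combination -hs

/-- For `n ≥ 2`, `d(2n−4, 4) = cₙ − 3·cₙ₋₁ + cₙ₋₂`. -/
theorem dyckD_isoline_four (n : ℕ) (hn : 2 ≤ n) :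
    (dyckD (2 * n - 4) 4 : ℤ) =
      catalan n - 3 * catalan (n - 1) + catalan (n - 2) := by
  obtain ⟨m, rfl⟩ : ∃ m, n = m + 2 := ⟨n - 2, by lia⟩
  rw [show 2 * (m + 2) - 4 = 2 * m by lia, show m + 2 - 1 = m + 1 by lia, Nat.add_sub_cancel,
    ← dyckD_two_mul_zero, ← dyckD_two_mul_zero, ← dyckD_two_mul_zero,
    show 2 * (m + 2) = 2 * m + 1 + 1 + 1 + 1 by lia, show 2 * (m + 1) = 2 * m + 1 + 1 by lia]
  simp only [dyckD_succ_zero, dyckD_succ_succ]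
  push_cast
  ring
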